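/- Let r ≥ 1 and work in the polynomial ring in variables x_1, …, x_r over ℚ. Let e_k denote the k-th elementary symmetric polynomial of x_1, …, x_r, and let Y be the family of the binom(r+1,2) sums x_i + x_j over pairs with 1 ≤ i ≤ j ≤ r. Then the third elementary symmetric polynomial of the family Y equals ((r+3)(r−1)(r−2)/6)·e_1³ + (r² + 2r − 4)·e_1·e_2 + (r + 4)·e_3. -/

import Mathlib

open MvPolynomial

theorem Multiset.esymm_cons_succ {R : Type*} [CommSemiring R] (a : R) (s : Multiset R) (n : ℕ) :
    (a ::ₘ s).esymm (n + 1) = s.esymm (n + 1) + a * s.esymm n := by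
  simp [Multiset.esymm, Multiset.powersetCard_cons, Multiset.map_map,
    Multiset.sum_map_mul_left]

theorem Multiset.esymm_zero_succ {R : Type*} [CommSemiring R] (n : ℕ) :
    (0 : Multiset R).esymm (n + 1) = 0 := by
  simp [Multiset.esymm, Multiset.powersetCard_zero_right]

theorem Multiset.esymm_one_eq_sum {R : Type*} [CommSemiring R] (s : Multiset R) :
    s.esymm 1 = s.sum := by
  simp [Multiset.esymm, Multiset.powersetCard_one, Multiset.map_map]

theorem Multiset.two_mul_esymm_two {R : Type*} [CommRing R] (s : Multiset R) :
    2 * s.esymm 2 = s.sum ^ 2 - (s.map (· ^ 2)).sum := by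
  induction s using Multiset.induction_on with
  | empty => simp [Multiset.esymm_zero_succ 1]
  | cons a s ih =>
    rw [Multiset.esymm_cons_succ a s 1, Multiset.esymm_one_eq_sum]
    simp only [Multiset.sum_cons, Multiset.map_cons]
    linear_combination ih

theorem Multiset.six_mul_esymm_three {R : Type*} [CommRing R] (s : Multiset R) :
    6 * s.esymm 3 =
      s.sum ^ 3 - 3 * s.sum * (s.map (· ^ 2)).sum + 2 * (s.map (· ^ 3)).sum := by
  induction s using Multiset.induction_on with
  | empty => simp [Multiset.esymm_zero_succ 2]
  | cons a s ih =>
    rw [Multiset.esymm_cons_succ a s 2]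
    simp only [Multiset.sum_cons, Multiset.map_cons]
    linear_combination ih + 3 * a * s.two_mul_esymm_two

theorem Finset.two_nsmul_sum_filter_le {ι M : Type*} [Fintype ι] [LinearOrder ι]
    [AddCommMonoid M] (f : ι → ι → M) (hf : ∀ i j, f i j = f j i) :
    2 • ∑ p : ι × ι with p.1 ≤ p.2, f p.1 p.2 = ∑ i, ∑ j, f i j + ∑ i, f i i := by
  have hswap : ∑ p : ι × ι with p.1 ≤ p.2, f p.1 p.2 =
      ∑ p : ι × ι with p.2 ≤ p.1, f p.1 p.2 := by
    simp only [Finset.sum_filter]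
    exact Fintype.sum_equiv (Equiv.prodComm ι ι) _ _ fun p => by rw [hf p.1 p.2]; rfl
  rw [two_nsmul]
  nth_rewrite 2 [hswap]
  simp only [Finset.sum_filter, Fintype.sum_prod_type, ← Finset.sum_add_distrib]
  refine Finset.sum_congr rfl fun i _ => ?_
  rw [← Fintype.sum_ite_eq i fun j => f i j, ← Finset.sum_add_distrib]
  refine Finset.sum_congr rfl fun j _ => ?_
  rcases lt_trichotomy i j with h | h | h
  · simp [h.le, h.not_ge, h.ne]
  · simp [h]
  · simp [h.le, h.not_ge, h.ne']

/-- Splitting-principle content of Corollary A.4(iii): if `Y` is the family of the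
`binom(r+1,2)` sums `xᵢ + xⱼ` over pairs with `i ≤ j`, then the third elementary
symmetric polynomial of `Y` equals
`((r+3)(r−1)(r−2)/6)·e₁³ + (r² + 2r − 4)·e₁·e₂ + (r+4)·e₃`. -/
theorem stmt_12 (r : ℕ) (hr : 1 ≤ r) :
    ((((Finset.univ : Finset (Fin r × Fin r)).filter (fun p => p.1 ≤ p.2)).val.map
        (fun p => (X p.1 + X p.2 : MvPolynomial (Fin r) ℚ))).esymm 3) =
      ((((r : ℚ) + 3) * ((r : ℚ) - 1) * ((r : ℚ) - 2)) / 6) • (esymm (Fin r) ℚ 1) ^ 3 +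
        ((r : ℚ) ^ 2 + 2 * r - 4) • (esymm (Fin r) ℚ 1 * esymm (Fin r) ℚ 2) +
        ((r : ℚ) + 4) • esymm (Fin r) ℚ 3 := by
  set Y := ((Finset.univ : Finset (Fin r × Fin r)).filter (fun p => p.1 ≤ p.2)).val.map
    (fun p => (X p.1 + X p.2 : MvPolynomial (Fin r) ℚ)) with hY
  set p₁ : MvPolynomial (Fin r) ℚ := ∑ i, X i with hp₁
  set p₂ : MvPolynomial (Fin r) ℚ := ∑ i, X i ^ 2 with hp₂
  set p₃ : MvPolynomial (Fin r) ℚ := ∑ i, X i ^ 3 with hp₃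
  have e₁ : esymm (Fin r) ℚ 1 = p₁ := by
    rw [esymm_eq_multiset_esymm, Multiset.esymm_one_eq_sum]; rfl
  have e₂ : 2 * esymm (Fin r) ℚ 2 = p₁ ^ 2 - p₂ := by
    rw [esymm_eq_multiset_esymm, Multiset.two_mul_esymm_two, Multiset.map_map]; rfl
  have e₃ : 6 * esymm (Fin r) ℚ 3 = p₁ ^ 3 - 3 * p₁ * p₂ + 2 * p₃ := by
    rw [esymm_eq_multiset_esymm, Multiset.six_mul_esymm_three, Multiset.map_map,
      Multiset.map_map]; rfl
  have two_mul_psum (k : ℕ) : 2 * (Y.map (· ^ k)).sum =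
      ∑ i, ∑ j, (X i + X j : MvPolynomial (Fin r) ℚ) ^ k + ∑ i, (X i + X i) ^ k := by
    rw [← Finset.two_nsmul_sum_filter_le
      (fun i j : Fin r => (X i + X j : MvPolynomial (Fin r) ℚ) ^ k)
      (fun i j => by rw [add_comm]), hY, Multiset.map_map, nsmul_eq_mul]
    rfl
  have two_ne : (2 : MvPolynomial (Fin r) ℚ) ≠ 0 := two_ne_zero
  have P₁ : Y.sum = (r + 1) * p₁ := by
    have h := two_mul_psum 1
    simp only [pow_one, Multiset.map_id', Finset.sum_add_distrib, Finset.sum_const,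
      Finset.card_univ, Fintype.card_fin, nsmul_eq_mul, ← Finset.mul_sum, ← hp₁] at h
    apply mul_left_cancel₀ two_ne
    linear_combination h
  have P₂ : (Y.map (· ^ 2)).sum = (r + 2) * p₂ + p₁ ^ 2 := by
    have h := two_mul_psum 2
    simp only [add_sq, Finset.sum_add_distrib, Finset.sum_const, Finset.card_univ,
      Fintype.card_fin, nsmul_eq_mul, ← Finset.mul_sum, ← Finset.sum_mul, mul_assoc, ← pow_two,
      ← hp₁, ← hp₂] at h
    apply mul_left_cancel₀ two_ne
    linear_combination h
  have P₃ : (Y.map (· ^ 3)).sum = (r + 4) * p₃ + 3 * p₁ * p₂ := by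
    have h := two_mul_psum 3
    have diag (i : Fin r) : (X i + X i : MvPolynomial (Fin r) ℚ) ^ 3 = 8 * X i ^ 3 := by ring
    have expand (i j : Fin r) : (X i + X j : MvPolynomial (Fin r) ℚ) ^ 3 =
        X i ^ 3 + 3 * (X i ^ 2 * X j) + 3 * (X i * X j ^ 2) + X j ^ 3 := by ring
    simp only [diag] at h
    simp only [expand, Finset.sum_add_distrib, Finset.sum_const, Finset.card_univ,
      Fintype.card_fin, nsmul_eq_mul, ← Finset.mul_sum, ← Finset.sum_mul,
      ← hp₁, ← hp₂, ← hp₃] at h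
    apply mul_left_cancel₀ two_ne
    linear_combination h
  have hY₃ := Y.six_mul_esymm_three
  rw [P₁, P₂, P₃] at hY₃
  have h6 : (6 : MvPolynomial (Fin r) ℚ) * C (6⁻¹) = 1 := by
    rw [← map_ofNat C 6, ← map_mul]; norm_num
  have six_ne : (6 : MvPolynomial (Fin r) ℚ) ≠ 0 := by norm_num
  apply mul_left_cancel₀ six_ne
  simp only [smul_eq_C_mul, div_eq_mul_inv, map_mul, map_add, map_sub, map_pow,
    map_natCast, map_ofNat, map_one, e₁]
  linear_combination hY₃ - (r + 3) * (r - 1) * (r - 2) * p₁ ^ 3 * h6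
    - 3 * (r ^ 2 + 2 * r - 4) * p₁ * e₂ - (r + 4) * e₃
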